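/- arXiv:2512.08111 — 4 statements merged into one kernel-verified Lean document; each statement's English description precedes it below -/
import Mathlib

section
/- Let I be a finite nonempty index set, let a ≤ b be real numbers, and for each i ∈ I let p_i and q_i be real numbers. Set A_i = ([a, p_i] ∪ [q_i, b]) ∩ [a, b] and l_i = [a, b] \ A_i. Then: (i) ⋃_{i∈I} l_i = [a, b] if and only if ⋂_{i∈I} A_i = ∅; and (ii) if ⋂_{i∈I} A_i ≠ ∅, then ⋂_{i∈I} A_i contains a point belonging to the set {a, b} ∪ {p_i : i ∈ I} ∪ {q_i : i ∈ I}. -/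
/-- Observation 3 of the paper: with `A i = ([a, p i] ∪ [q i, b]) ∩ [a, b]` and
`l i = [a, b] \ A i`, (i) the complements `l i` cover `[a, b]` iff no point lies in all
the `A i`; (ii) if some point lies in all the `A i`, then such a point can be found among
`{a, b} ∪ {p i} ∪ {q i}` (endpoints of the complement segments). -/
theorem stmt_0 {I : Type*} [Fintype I] [Nonempty I] (a b : ℝ) (hab : a ≤ b)
    (p q : I → ℝ)
    (A : I → Set ℝ)
    (hA : ∀ i, A i = (Set.Icc a (p i) ∪ Set.Icc (q i) b) ∩ Set.Icc a b)
    (l : I → Set ℝ) (hl : ∀ i, l i = Set.Icc a b \ A i) :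
    ((⋃ i, l i) = Set.Icc a b ↔ (⋂ i, A i) = ∅) ∧
    ((⋂ i, A i) ≠ ∅ →
      ∃ x ∈ ⋂ i, A i, x ∈ ({a, b} : Set ℝ) ∪ Set.range p ∪ Set.range q) := by
  have hmem : ∀ i x, x ∈ A i ↔ (x ≤ p i ∨ q i ≤ x) ∧ a ≤ x ∧ x ≤ b := by
    intro i x
    rw [hA]
    simp only [Set.mem_inter_iff, Set.mem_union, Set.mem_Icc]
    tauto
  refine ⟨?_, ?_⟩
  · have hsub : (⋂ i, A i) ⊆ Set.Icc a b := fun x hx =>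
      ((hmem (Classical.arbitrary I) x).1 (Set.mem_iInter.1 hx _)).2
    have hU : (⋃ i, l i) = Set.Icc a b \ ⋂ i, A i := by
      simp only [hl, Set.sdiff_iInter]
    rw [hU, sdiff_eq_left, disjoint_comm, Set.disjoint_iff_inter_eq_empty,
      Set.inter_eq_left.2 hsub]
  · intro h
    obtain ⟨x, hx⟩ := Set.nonempty_iff_ne_empty.2 h
    have hx' := fun i => (hmem i x).1 (Set.mem_iInter.1 hx i)
    obtain ⟨-, hax, hxb⟩ := hx' (Classical.arbitrary I)
    -- Move `x` left to the largest element of `{a} ∪ {q i}` not exceeding it.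
    obtain ⟨z, ⟨hz, hzx⟩, hmax⟩ := Set.exists_max_image
      (insert a (Set.range q) ∩ Set.Iic x) id
      (((Set.finite_range q).insert a).inter_of_left _) ⟨a, Set.mem_insert _ _, hax⟩
    have haz : a ≤ z := hmax a ⟨Set.mem_insert _ _, hax⟩
    refine ⟨z, Set.mem_iInter.2 fun i => (hmem i z).2 ⟨?_, haz, le_trans hzx hxb⟩, ?_⟩
    · rcases (hx' i).1 with hp | hq
      · exact Or.inl (le_trans hzx hp)
      · exact Or.inr (hmax (q i) ⟨Set.mem_insert_of_mem _ ⟨i, rfl⟩, hq⟩)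
    · rcases hz with rfl | hz
      · exact Or.inl (Or.inl (Or.inl rfl))
      · exact Or.inr hz
end

section
/- Let I be a finite nonempty index set and, for each i ∈ I, let J_i be a finite index set; for each i ∈ I and j ∈ J_i let K_{i,j} = [c_{i,j}, d_{i,j}] × [e_{i,j}, f_{i,j}] be a closed axis-parallel rectangle in ℝ². If the set ⋂_{i∈I} ⋃_{j∈J_i} K_{i,j} is nonempty, then it contains a point (x, y) such that x = c_{i,j} for some i ∈ I and j ∈ J_i, and y = e_{i',j'} for some i' ∈ I and j' ∈ J_{i'}. -/
/-- The canonical-piercing-point fact behind Observation 4 of the paper: if a point lies in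
at least one rectangle of each finite family `{K i j : j ∈ J i}` of closed axis-parallel
rectangles, then such a point can be chosen to lie on the left side of some rectangle and on
the bottom side of some rectangle. -/
theorem stmt_1 {I : Type*} [Fintype I] [Nonempty I]
    (J : I → Type*) [∀ i, Fintype (J i)]
    (c d e f : (i : I) → J i → ℝ)
    (K : (i : I) → J i → Set (ℝ × ℝ))
    (hK : ∀ i j, K i j = Set.Icc (c i j) (d i j) ×ˢ Set.Icc (e i j) (f i j))
    (hne : (⋂ i, ⋃ j, K i j).Nonempty) :
    ∃ z ∈ ⋂ i, ⋃ j, K i j,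
      (∃ i : I, ∃ j : J i, z.1 = c i j) ∧ (∃ i' : I, ∃ j' : J i', z.2 = e i' j') := by
  obtain ⟨p, hp⟩ := hne
  simp only [Set.mem_iInter, Set.mem_iUnion] at hp
  choose j hj using hp
  simp only [hK, Set.mem_prod, Set.mem_Icc] at hj
  obtain ⟨a, ha⟩ := Finite.exists_max fun i => c i (j i)
  obtain ⟨b, hb⟩ := Finite.exists_max fun i => e i (j i)
  refine ⟨(c a (j a), e b (j b)), ?_, ⟨a, j a, rfl⟩, ⟨b, j b, rfl⟩⟩
  simp only [Set.mem_iInter, Set.mem_iUnion]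
  intro i
  refine ⟨j i, ?_⟩
  rw [hK]
  exact ⟨⟨ha i, (hj a).1.1.trans (hj i).1.2⟩, ⟨hb i, (hj b).2.1.trans (hj i).2.2⟩⟩
end

section
/- Let G be a finite tree with vertex set V and graph distance d, let W ⊆ V be nonempty, and let α, β ∈ W satisfy d(α, β) = max_{u,w ∈ W} d(u, w). Then every vertex v ∈ V satisfies max_{w ∈ W} d(v, w) = max(d(v, α), d(v, β)). -/
namespace SimpleGraph

variable {V : Type*} {G : SimpleGraph V}

lemma IsTree.length_eq_dist_of_isPath (hT : G.IsTree) {u v : V} {p : G.Walk u v}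
    (hp : p.IsPath) : p.length = G.dist u v := by
  obtain ⟨q, hq, hlen⟩ := hT.connected.exists_path_of_dist u v
  rw [← hlen, (hT.existsUnique_path u v).unique hp hq]

lemma IsTree.dist_add_dist_of_mem_support (hT : G.IsTree) {u v x : V} {p : G.Walk u v}
    (hp : p.IsPath) (hx : x ∈ p.support) : G.dist u x + G.dist x v = G.dist u v := by
  classical
  rw [← hT.length_eq_dist_of_isPath (hp.takeUntil hx),
    ← hT.length_eq_dist_of_isPath (hp.dropUntil hx), ← hT.length_eq_dist_of_isPath hp,
    ← Walk.length_append, Walk.take_spec]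

/-- If `z` is a vertex of a path nearest to `c`, the geodesic from `c` to the end of the path
passes through `z`. -/
lemma IsTree.dist_eq_add_of_nearest (hT : G.IsTree) {u v c z : V} {p : G.Walk u v}
    (hp : p.IsPath) (hz : z ∈ p.support) (hmin : ∀ x ∈ p.support, G.dist c z ≤ G.dist c x) :
    G.dist c v = G.dist c z + G.dist z v := by
  classical
  obtain ⟨q, hq, hlen⟩ := hT.connected.exists_path_of_dist c z
  have hr := hp.dropUntil hz
  have happ : (q.append (p.dropUntil z hz)).IsPath := by
    rw [Walk.isPath_def, Walk.support_append, List.nodup_append']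
    refine ⟨hq.support_nodup, hr.support_nodup.tail, fun x hxq hxr => ?_⟩
    have hle := hmin x (p.support_dropUntil_subset_support hz (List.mem_of_mem_tail hxr))
    have hadd := hT.dist_add_dist_of_mem_support hq hxq
    obtain rfl : x = z := hT.connected.dist_eq_zero_iff.mp (by omega)
    have hnodup := hr.support_nodup
    rw [← Walk.cons_tail_support] at hnodup
    exact (List.nodup_cons.mp hnodup).1 hxr
  rw [← hT.length_eq_dist_of_isPath happ, Walk.length_append, hlen,
    hT.length_eq_dist_of_isPath hr]

lemma IsTree.exists_mem_support_dist_eq_add (hT : G.IsTree) {u v : V} {p : G.Walk u v}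
    (hp : p.IsPath) (c : V) :
    ∃ z ∈ p.support, G.dist c u = G.dist c z + G.dist z u ∧
      G.dist c v = G.dist c z + G.dist z v := by
  classical
  obtain ⟨z, hz, hmin⟩ := p.support.toFinset.exists_min_image (G.dist c)
    ⟨u, by simp⟩
  simp only [List.mem_toFinset] at hz hmin
  exact ⟨z, hz, hT.dist_eq_add_of_nearest hp.reverse (by simpa using hz) (by simpa using hmin),
    hT.dist_eq_add_of_nearest hp hz hmin⟩

/-- The four-point condition for the distance of a tree. -/
lemma IsTree.dist_add_dist_le_max (hT : G.IsTree) (a b c d : V) :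
    G.dist c d + G.dist a b ≤
      max (G.dist c a + G.dist d b) (G.dist c b + G.dist d a) := by
  classical
  obtain ⟨p, hp, -⟩ := hT.connected.exists_path_of_dist a b
  obtain ⟨z, hz, hza, hzb⟩ := hT.exists_mem_support_dist_eq_add hp c
  obtain ⟨y, hy, hya, hyb⟩ := hT.exists_mem_support_dist_eq_add hp d
  have habz := hT.dist_add_dist_of_mem_support hp hz
  have haby := hT.dist_add_dist_of_mem_support hp hy
  have hcy := hT.connected.dist_triangle (u := c) (v := z) (w := y)
  have hcd := hT.connected.dist_triangle (u := c) (v := y) (w := d)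
  rw [G.dist_comm (u := a) (v := z)] at habz
  rw [G.dist_comm (u := a) (v := y)] at haby
  rw [G.dist_comm (u := y) (v := d)] at hcd
  rw [← p.take_spec hz, Walk.mem_support_append_iff] at hy
  rcases hy with hy | hy
  · have h := hT.dist_add_dist_of_mem_support (hp.takeUntil hz) hy
    rw [G.dist_comm (u := a) (v := y), G.dist_comm (u := a) (v := z),
      G.dist_comm (u := y) (v := z)] at h
    omega
  · have h := hT.dist_add_dist_of_mem_support (hp.dropUntil hz) hy
    omega

end SimpleGraph


/-- The diametral-pair fact underlying Lemma 7 of the paper: if `α, β ∈ W` form a diametral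
pair of a nonempty vertex set `W` of a finite tree, then for every vertex `v`, the farthest
vertex of `W` from `v` is realized at `α` or `β`:
`max_{w ∈ W} d(v, w) = max(d(v, α), d(v, β))`. -/
theorem stmt_5 {V : Type*} [Fintype V] (G : SimpleGraph V) (hT : G.IsTree)
    (W : Finset V) (hW : W.Nonempty)
    (α β : V) (hα : α ∈ W) (hβ : β ∈ W)
    (hαβ : G.dist α β = W.sup fun x => W.sup fun y => G.dist x y) :
    ∀ v : V, (W.sup fun x => G.dist v x) = max (G.dist v α) (G.dist v β) := by
  intro v
  refine le_antisymm (Finset.sup_le fun w hw => ?_)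
    (max_le (Finset.le_sup (f := fun x => G.dist v x) hα)
      (Finset.le_sup (f := fun x => G.dist v x) hβ))
  have hdiam : ∀ x ∈ W, G.dist w x ≤ G.dist α β := fun x hx => by
    rw [hαβ]
    exact (Finset.le_sup (f := fun y => G.dist w y) hx).trans
      (Finset.le_sup (f := fun x => W.sup fun y => G.dist x y) hw)
  have hfour := hT.dist_add_dist_le_max α β v w
  have hwα := hdiam α hα
  have hwβ := hdiam β hβ
  omega
end

section
/- Let G be a finite tree with vertex set V and graph distance d, and let P₁, …, P_k (k ≥ 1) be pairwise disjoint pairs P_i = {v_i, u_i} of distinct vertices of G. Then min over all vertices c₁, c₂ ∈ V of max_{1≤i≤k} min( max(d(v_i, c₁), d(u_i, c₂)), max(d(u_i, c₁), d(v_i, c₂)) ) equals min over all assignments σ of max( ⌈diam(Red(σ))/2⌉, ⌈diam(Blue(σ))/2⌉ ). -/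
/-- The diameter of a finite vertex set `S` in a graph `G`: `max_{x,y ∈ S} d(x, y)`. -/
noncomputable def finsetDiam {V : Type*} (G : SimpleGraph V) (S : Finset V) : ℕ :=
  S.sup fun x => S.sup fun y => G.dist x y

/-- The set of red vertices under the assignment `σ`: from each pair `{v i, u i}`, the vertex
`v i` is red if `σ i = true`, and otherwise `u i` is red. -/
def redSet {V : Type*} [DecidableEq V] {k : ℕ} (v u : Fin k → V)
    (σ : Fin k → Bool) : Finset V :=
  Finset.univ.image fun i => if σ i then v i else u i

/-- The set of blue vertices under the assignment `σ` (the other vertex of each pair). -/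
def blueSet {V : Type*} [DecidableEq V] {k : ℕ} (v u : Fin k → V)
    (σ : Fin k → Bool) : Finset V :=
  Finset.univ.image fun i => if σ i then u i else v i

namespace SimpleGraph

variable {V : Type*} {G : SimpleGraph V}

/-- A vertex distinct from `x` has a neighbor that is one step closer to `x`. -/
lemma Connected.exists_adj_dist_succ (hG : G.Connected) {x c : V} (hne : x ≠ c) :
    ∃ c', G.Adj c' c ∧ G.dist x c = G.dist x c' + 1 := by
  obtain ⟨p, hp⟩ := hG.exists_walk_length_eq_dist c x
  cases p with
  | nil => exact absurd rfl hne
  | @cons _ c' _ h q =>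
    refine ⟨c', h.symm, ?_⟩
    have h₁ := dist_le q
    have h₂ := hG.dist_triangle (u := c) (v := c') (w := x)
    rw [dist_eq_one_iff_adj.mpr h] at h₂
    rw [Walk.length_cons] at hp
    rw [G.dist_comm (u := x) (v := c), G.dist_comm (u := x) (v := c')]
    omega

/-- In a tree, the neighbor of `c` that is closer to `x` is unique. -/
lemma IsTree.eq_of_adj_of_dist_succ (hT : G.IsTree) {x c a b : V} (ha : G.Adj a c)
    (hb : G.Adj b c) (hda : G.dist x c = G.dist x a + 1) (hdb : G.dist x c = G.dist x b + 1) :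
    a = b := by
  obtain ⟨p, hp⟩ := hT.connected.exists_walk_length_eq_dist x a
  obtain ⟨q, hq⟩ := hT.connected.exists_walk_length_eq_dist x b
  have hp' := (p.concat ha).isPath_of_length_eq_dist (by simp [hp, hda])
  have hq' := (q.concat hb).isPath_of_length_eq_dist (by simp [hq, hdb])
  have h := congrArg Subtype.val
    ((hT.isAcyclic.subsingleton_path x c).elim ⟨_, hp'⟩ ⟨_, hq'⟩)
  exact (Walk.concat_inj h).1

/-- Distances in a tree add up across an edge that separates the two endpoints. -/
lemma IsTree.dist_eq_of_adj (hT : G.IsTree) {x y c c' : V} (hadj : G.Adj c' c)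
    (hx : G.dist x c = G.dist x c' + 1) (hy : G.dist y c' = G.dist y c + 1) :
    G.dist x y = G.dist x c + G.dist y c := by
  induction hn : G.dist y c generalizing c c' with
  | zero =>
    rw [hT.connected.dist_eq_zero_iff.mp hn, add_zero]
  | succ n ih =>
    have hne : y ≠ c := by
      rintro rfl
      simp at hn
    obtain ⟨d, hd, hyd⟩ := hT.connected.exists_adj_dist_succ hne
    rcases hT.dist_eq_dist_add_one_of_adj x hd with h | h
    · have := ih hd.symm h hyd (by omega)
      omega
    · have := hT.eq_of_adj_of_dist_succ hadj hd hx h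
      subst this
      omega

/-- A finite vertex set of a tree with pairwise distances at most `2 * r` is contained in a closed
ball of radius `r`. -/
lemma IsTree.exists_forall_dist_le [Finite V] (hT : G.IsTree) (S : Finset V) (r : ℕ)
    (hS : ∀ x ∈ S, ∀ y ∈ S, G.dist x y ≤ 2 * r) : ∃ c, ∀ x ∈ S, G.dist x c ≤ r := by
  have := hT.connected.nonempty
  obtain ⟨c, hc⟩ := Finite.exists_min fun c ↦ S.sup fun x ↦ G.dist x c
  refine ⟨c, ?_⟩
  by_contra! ⟨z, hz, hrz⟩
  obtain ⟨x, hx, hxc⟩ := S.exists_mem_eq_sup ⟨z, hz⟩ fun x ↦ G.dist x c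
  have hmax : ∀ w ∈ S, G.dist w c ≤ G.dist x c := fun w hw ↦
    hxc ▸ Finset.le_sup (f := fun x ↦ G.dist x c) hw
  have hzx := hmax z hz
  have hne : x ≠ c := by
    rintro rfl
    rw [dist_self] at hzx
    omega
  obtain ⟨c', hadj, hxc'⟩ := hT.connected.exists_adj_dist_succ hne
  obtain ⟨y, hy, hyc'⟩ := S.exists_mem_eq_sup ⟨z, hz⟩ fun x ↦ G.dist x c'
  have hmin := hc c'
  rw [hxc, hyc'] at hmin
  have hyc := hmax y hy
  have hxy := hS x hx y hy
  rcases hT.dist_eq_dist_add_one_of_adj y hadj with h | h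
  · have := hT.dist_eq_of_adj hadj hxc' h
    omega
  · omega

end SimpleGraph

lemma dist_le_finsetDiam {V : Type*} (G : SimpleGraph V) {S : Finset V} {x y : V} (hx : x ∈ S)
    (hy : y ∈ S) : G.dist x y ≤ finsetDiam G S :=
  (Finset.le_sup (f := fun y ↦ G.dist x y) hy).trans
    (Finset.le_sup (f := fun x ↦ S.sup fun y ↦ G.dist x y) hx)

lemma SimpleGraph.Connected.finsetDiam_le {V : Type*} {G : SimpleGraph V} (hG : G.Connected)
    {S : Finset V} {c : V} {r : ℕ} (h : ∀ x ∈ S, G.dist x c ≤ r) : finsetDiam G S ≤ 2 * r := by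
  refine Finset.sup_le fun x hx ↦ Finset.sup_le fun y hy ↦ ?_
  have h₁ := hG.dist_triangle (u := x) (v := c) (w := y)
  rw [G.dist_comm (u := c)] at h₁
  have := h x hx
  have := h y hy
  omega

lemma SimpleGraph.IsTree.exists_forall_dist_le_finsetDiam {V : Type*} [Finite V]
    {G : SimpleGraph V} (hT : G.IsTree) (S : Finset V) :
    ∃ c, ∀ x ∈ S, G.dist x c ≤ (finsetDiam G S + 1) / 2 :=
  hT.exists_forall_dist_le S _ fun x hx y hy ↦ by
    have := dist_le_finsetDiam G hx hy
    omega

/-- The discrete content of Observation 6 of the paper: for pairwise disjoint pairs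
`P i = {v i, u i}` of distinct vertices of a finite tree, the vertex-restricted bichromatic
two-center objective equals the minimum over all assignments `σ` of
`max(⌈diam(Red(σ))/2⌉, ⌈diam(Blue(σ))/2⌉)`. -/
theorem stmt_8 {V : Type*} [Fintype V] [DecidableEq V] (G : SimpleGraph V)
    (hT : G.IsTree) (k : ℕ) (hk : 1 ≤ k) (v u : Fin k → V)
    (hvu : ∀ i, v i ≠ u i)
    (hdisj : ∀ i j : Fin k, i ≠ j → ({v i, u i} : Set V) ∩ {v j, u j} = ∅) :
    sInf { n : ℕ | ∃ c₁ c₂ : V,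
        n = Finset.univ.sup fun i : Fin k =>
          min (max (G.dist (v i) c₁) (G.dist (u i) c₂))
              (max (G.dist (u i) c₁) (G.dist (v i) c₂)) }
      =
    sInf { n : ℕ | ∃ σ : Fin k → Bool,
        n = max ((finsetDiam G (redSet v u σ) + 1) / 2)
                ((finsetDiam G (blueSet v u σ) + 1) / 2) } := by
  have := hT.connected.nonempty
  apply le_antisymm
  · refine le_csInf ⟨_, fun _ ↦ true, rfl⟩ ?_
    rintro _ ⟨σ, rfl⟩
    obtain ⟨c₁, h₁⟩ := hT.exists_forall_dist_le_finsetDiam (redSet v u σ)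
    obtain ⟨c₂, h₂⟩ := hT.exists_forall_dist_le_finsetDiam (blueSet v u σ)
    refine (Nat.sInf_le (Set.mem_ofPred.mpr ⟨c₁, c₂, rfl⟩)).trans (Finset.sup_le fun i _ ↦ ?_)
    have hr := h₁ _ (Finset.mem_image_of_mem _ (Finset.mem_univ i))
    have hb := h₂ _ (Finset.mem_image_of_mem _ (Finset.mem_univ i))
    cases hσ : σ i
    · simp only [hσ, Bool.false_eq_true, if_false] at hr hb
      exact (min_le_right _ _).trans (max_le_max hr hb)
    · simp only [hσ, if_true] at hr hb
      exact (min_le_left _ _).trans (max_le_max hr hb)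
  · refine le_csInf ⟨_, Classical.arbitrary V, Classical.arbitrary V, rfl⟩ ?_
    rintro n ⟨c₁, c₂, hn⟩
    let σ : Fin k → Bool := fun i ↦ decide (max (G.dist (v i) c₁) (G.dist (u i) c₂) ≤ n)
    have hi (i : Fin k) := hn ▸ Finset.le_sup (f := fun i : Fin k ↦
          min (max (G.dist (v i) c₁) (G.dist (u i) c₂))
              (max (G.dist (u i) c₁) (G.dist (v i) c₂))) (Finset.mem_univ i)
    have hr : finsetDiam G (redSet v u σ) ≤ 2 * n := hT.connected.finsetDiam_le (c := c₁) (by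
      intro x hx
      obtain ⟨i, -, rfl⟩ := Finset.mem_image.mp hx
      have := hi i
      by_cases h : max (G.dist (v i) c₁) (G.dist (u i) c₂) ≤ n <;>
        simp only [σ, h, decide_true, decide_false, if_true, if_false, Bool.false_eq_true] <;> omega)
    have hb : finsetDiam G (blueSet v u σ) ≤ 2 * n := hT.connected.finsetDiam_le (c := c₂) (by
      intro x hx
      obtain ⟨i, -, rfl⟩ := Finset.mem_image.mp hx
      have := hi i
      by_cases h : max (G.dist (v i) c₁) (G.dist (u i) c₂) ≤ n <;>
        simp only [σ, h, decide_true, decide_false, if_true, if_false, Bool.false_eq_true] <;> omega)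
    exact (Nat.sInf_le (Set.mem_ofPred.mpr ⟨σ, rfl⟩)).trans (by omega)
end
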